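/- arXiv:1507.06879 — 7 statements merged into one kernel-verified Lean document; each statement's English description precedes it below -/
import Mathlib

section
/- Let N be a positive integer and ξ = exp(2πi/N). Then there exists a constant C > 0 such that for every ε > 0 and every convex combination w = Σ_{j=0}^{N−1} α_j ξ^j of the N-th roots of unity (α_j ≥ 0, Σ_{j=0}^{N−1} α_j = 1) satisfying 1 − ε < |w| ≤ 1, there exists an index 0 ≤ i ≤ N−1 with 1 − Cε < α_i ≤ 1. -/
/-- For distinct unit vectors, the inner products stay uniformly away from `1`. -/
theorem exists_pos_one_le_mul_one_sub_inner {ι E : Type*} [Finite ι] [NormedAddCommGroup E]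
    [InnerProductSpace ℝ E] {z : ι → E} (hz : ∀ i, ‖z i‖ = 1) (hinj : Function.Injective z) :
    ∃ M : ℝ, 0 < M ∧ ∀ i j, i ≠ j → 1 ≤ M * (1 - inner ℝ (z i) (z j)) := by
  obtain ⟨M, hM⟩ := Finite.exists_le fun p : ι × ι => (1 - inner ℝ (z p.1) (z p.2))⁻¹
  refine ⟨max M 1, by positivity, fun i j hij => ?_⟩
  have hlt : inner ℝ (z i) (z j) < 1 :=
    (inner_lt_one_iff_real_of_norm_eq_one (hz i) (hz j)).2 (hinj.ne hij)
  have hpos : 0 < 1 - inner ℝ (z i) (z j) := sub_pos.2 hlt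
  calc (1 : ℝ) = (1 - inner ℝ (z i) (z j))⁻¹ * (1 - inner ℝ (z i) (z j)) :=
        (inv_mul_cancel₀ hpos.ne').symm
    _ ≤ max M 1 * (1 - inner ℝ (z i) (z j)) := by
        gcongr
        exact (hM (i, j)).trans (le_max_left _ _)

/-- A convex combination of distinct unit vectors which is nearly a unit vector has squared weights
summing to nearly `1`. -/
theorem one_sub_sum_sq_le_mul_one_sub_norm_sq {ι E : Type*} [Fintype ι] [NormedAddCommGroup E]
    [InnerProductSpace ℝ E] {z : ι → E} (hz : ∀ i, ‖z i‖ = 1) {M : ℝ}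
    (hM : ∀ i j, i ≠ j → 1 ≤ M * (1 - inner ℝ (z i) (z j))) {α : ι → ℝ} (hα : ∀ i, 0 ≤ α i)
    (hsum : ∑ i, α i = 1) :
    1 - ∑ i, α i ^ 2 ≤ M * (1 - ‖∑ i, α i • z i‖ ^ 2) := by
  classical
  have hprod : ∑ i, ∑ j, α i * α j = 1 := by
    rw [← Finset.sum_mul_sum, hsum, one_mul]
  have hdiag : ∑ i, α i ^ 2 = ∑ i, ∑ j, if i = j then α i * α j else 0 := by
    simp [sq]
  have hnorm : ‖∑ i, α i • z i‖ ^ 2 = ∑ i, ∑ j, α i * α j * inner ℝ (z i) (z j) := by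
    rw [← real_inner_self_eq_norm_sq, sum_inner]
    refine Finset.sum_congr rfl fun i _ => ?_
    rw [inner_sum]
    refine Finset.sum_congr rfl fun j _ => ?_
    rw [real_inner_smul_left, real_inner_smul_right, mul_assoc]
  rw [hdiag, hnorm, ← hprod]
  simp only [← Finset.sum_sub_distrib, Finset.mul_sum]
  refine Finset.sum_le_sum fun i _ => Finset.sum_le_sum fun j _ => ?_
  split_ifs with h
  · subst h
    simp [hz]
  · nlinarith [mul_le_mul_of_nonneg_left (hM i j h) (mul_nonneg (hα i) (hα j))]

/-- The largest weight dominates the sum of the squares of the weights. -/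
theorem exists_sum_sq_le_of_sum_eq_one {ι : Type*} [Fintype ι] [Nonempty ι] {α : ι → ℝ}
    (hα : ∀ i, 0 ≤ α i) (hsum : ∑ i, α i = 1) : ∃ i, ∑ j, α j ^ 2 ≤ α i := by
  obtain ⟨i, hi⟩ := Finite.exists_max α
  refine ⟨i, ?_⟩
  calc ∑ j, α j ^ 2 ≤ ∑ j, α i * α j :=
        Finset.sum_le_sum fun j _ => by
          rw [sq]
          exact mul_le_mul_of_nonneg_right (hi j) (hα j)
    _ = α i := by rw [← Finset.mul_sum, hsum, mul_one]

/-- **Geometric lemma** (Lemma 4.1 of the paper).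
Let `N` be a positive integer and `ξ = exp(2πi/N)`. There exists a constant `C > 0` such
that for every `ε > 0` and every convex combination `w = Σ_{j<N} α_j ξ^j` of the `N`-th
roots of unity with `1 - ε < |w| ≤ 1`, some coefficient satisfies `1 - C·ε < α_i ≤ 1`. -/
theorem stmt0 (N : ℕ) (hN : 0 < N) :
    ∃ C : ℝ, 0 < C ∧
      ∀ ε : ℝ, 0 < ε →
        ∀ α : Fin N → ℝ, (∀ j, 0 ≤ α j) → (∑ j, α j = 1) →
          (1 - ε <
              norm (∑ j : Fin N,
                (α j : ℂ) * Complex.exp (2 * ↑Real.pi * Complex.I / N) ^ (j : ℕ)) ∧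
            norm (∑ j : Fin N,
                (α j : ℂ) * Complex.exp (2 * ↑Real.pi * Complex.I / N) ^ (j : ℕ)) ≤ 1) →
          ∃ i : Fin N, 1 - C * ε < α i ∧ α i ≤ 1 := by
  have : Nonempty (Fin N) := ⟨⟨0, hN⟩⟩
  have hprim := Complex.isPrimitiveRoot_exp N hN.ne'
  set ξ := Complex.exp (2 * ↑Real.pi * Complex.I / N)
  have hz : ∀ j : Fin N, ‖ξ ^ (j : ℕ)‖ = 1 := fun j => by
    rw [norm_pow, hprim.norm'_eq_one hN.ne', one_pow]
  have hinj : Function.Injective fun j : Fin N => ξ ^ (j : ℕ) := fun i j hij =>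
    Fin.ext (hprim.pow_inj i.isLt j.isLt hij)
  obtain ⟨M, hM0, hM⟩ := exists_pos_one_le_mul_one_sub_inner hz hinj
  refine ⟨2 * M, by positivity, fun ε _ α hα hsum hw => ?_⟩
  obtain ⟨i, hi⟩ := exists_sum_sq_le_of_sum_eq_one hα hsum
  refine ⟨i, ?_, hsum ▸ Finset.single_le_sum (fun j _ => hα j) (Finset.mem_univ i)⟩
  have hle := one_sub_sum_sq_le_mul_one_sub_norm_sq hz hM hα hsum
  simp only [Complex.real_smul] at hle
  obtain ⟨hlow, hup⟩ := hw
  set r := ‖∑ j : Fin N, (α j : ℂ) * ξ ^ (j : ℕ)‖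
  have hr : 1 - r ^ 2 < 2 * ε := by
    nlinarith [sq_nonneg (1 - r)]
  nlinarith [mul_lt_mul_of_pos_left hr hM0]
end

section
/- Let N ≥ 2 be an integer, let ξ = exp(2πi/N), and let β be a real number with 0 ≤ β ≤ 1 − 1/N. Then |1 + β(ξ − 1)| = √(1 − 2β(1−β)(1 − cos(2π/N))), and moreover |1 + β(ξ − 1)| ≤ 1 − β(1 − cos(2π/N))/N. -/
theorem norm_one_add_mul_exp_mul_I_sub_one (β θ : ℝ) :
    ‖1 + (β : ℂ) * (Complex.exp (θ * Complex.I) - 1)‖ =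
      Real.sqrt (1 - 2 * β * (1 - β) * (1 - Real.cos θ)) := by
  rw [Complex.norm_def, Complex.normSq_apply]
  congr 1
  simp only [Complex.add_re, Complex.add_im, Complex.one_re, Complex.one_im, Complex.sub_re,
    Complex.sub_im, Complex.re_ofReal_mul, Complex.im_ofReal_mul, Complex.exp_ofReal_mul_I_re,
    Complex.exp_ofReal_mul_I_im]
  linear_combination β ^ 2 * Real.sin_sq_add_cos_sq θ

theorem sqrt_one_sub_two_mul_le {x : ℝ} (hx : x ≤ 1) : Real.sqrt (1 - 2 * x) ≤ 1 - x :=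
  Real.sqrt_le_iff.mpr ⟨by linarith, by nlinarith [sq_nonneg x]⟩

/-- The key computation in the proof of Lemma 4.1 of the paper.
For an integer `N ≥ 2`, `ξ = exp(2πi/N)` and a real `β` with `0 ≤ β ≤ 1 - 1/N`, one has
`|1 + β(ξ - 1)| = √(1 - 2β(1-β)(1 - cos(2π/N)))` and
`|1 + β(ξ - 1)| ≤ 1 - β(1 - cos(2π/N))/N`. -/
theorem stmt1 (N : ℕ) (hN : 2 ≤ N) (β : ℝ) (hβ0 : 0 ≤ β) (hβ1 : β ≤ 1 - 1 / N) :
    ‖1 + (β : ℂ) * (Complex.exp (2 * ↑Real.pi * Complex.I / N) - 1)‖ =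
        Real.sqrt (1 - 2 * β * (1 - β) * (1 - Real.cos (2 * Real.pi / N))) ∧
      ‖1 + (β : ℂ) * (Complex.exp (2 * ↑Real.pi * Complex.I / N) - 1)‖ ≤
        1 - β * (1 - Real.cos (2 * Real.pi / N)) / N := by
  have harg : 2 * (Real.pi : ℂ) * Complex.I / N =
      ((2 * Real.pi / N : ℝ) : ℂ) * Complex.I := by
    push_cast
    ring
  rw [harg, norm_one_add_mul_exp_mul_I_sub_one]
  refine ⟨rfl, ?_⟩
  set c := 1 - Real.cos (2 * Real.pi / N)
  have hc0 : 0 ≤ c := sub_nonneg.mpr (Real.cos_le_one _)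
  have hc2 : c ≤ 2 := by linarith [Real.neg_one_le_cos (2 * Real.pi / N)]
  have hx : β * (1 - β) * c ≤ 1 := by
    nlinarith [mul_nonneg hc0 (sq_nonneg (β - 1 / 2))]
  calc Real.sqrt (1 - 2 * β * (1 - β) * c)
      = Real.sqrt (1 - 2 * (β * (1 - β) * c)) := by ring_nf
    _ ≤ 1 - β * (1 - β) * c := sqrt_one_sub_two_mul_le hx
    _ ≤ 1 - β * c / N := by
      have h := mul_le_mul_of_nonneg_left (le_sub_comm.mp hβ1) (mul_nonneg hβ0 hc0)
      rw [mul_one_div] at h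
      linarith
end

section
/- Let N ≥ 2 be an integer, let ξ = exp(2πi/N), let α, β ≥ 0 be real numbers with α + β = 1, let 0 ≤ i ≤ N−1, and let z be any point of the convex hull of the set {ξ^j : 0 ≤ j ≤ N−1, j ≠ i} of N-th roots of unity different from ξ^i. Then |α ξ^i + β z| ≤ |α ξ^i + β ξ^{i+1}| (index i+1 taken modulo N), and the right-hand side equals |α + β ξ|. -/
/-- The law of cosines for a real combination of two points of the unit circle. -/
theorem norm_sq_add_exp_mul_I (α β a b : ℝ) :
    ‖(α : ℂ) * Complex.exp (a * Complex.I) + (β : ℂ) * Complex.exp (b * Complex.I)‖ ^ 2 =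
      α ^ 2 + β ^ 2 + 2 * (α * β) * Real.cos (b - a) := by
  rw [← Complex.normSq_eq_norm_sq, Complex.normSq_apply]
  simp only [Complex.add_re, Complex.add_im, Complex.re_ofReal_mul, Complex.im_ofReal_mul,
    Complex.exp_ofReal_mul_I_re, Complex.exp_ofReal_mul_I_im, Real.cos_sub]
  linear_combination α ^ 2 * Real.sin_sq_add_cos_sq a + β ^ 2 * Real.sin_sq_add_cos_sq b

theorem norm_add_exp_mul_I_le {α β a b c d : ℝ} (hα : 0 ≤ α) (hβ : 0 ≤ β)
    (h : Real.cos (b - a) ≤ Real.cos (d - c)) :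
    ‖(α : ℂ) * Complex.exp (a * Complex.I) + (β : ℂ) * Complex.exp (b * Complex.I)‖ ≤
      ‖(α : ℂ) * Complex.exp (c * Complex.I) + (β : ℂ) * Complex.exp (d * Complex.I)‖ := by
  refine le_of_sq_le_sq ?_ (norm_nonneg _)
  rw [norm_sq_add_exp_mul_I, norm_sq_add_exp_mul_I]
  gcongr

theorem Real.cos_le_cos_of_le_of_le_two_pi_sub {s t : ℝ} (hs : 0 ≤ s) (hst : s ≤ t)
    (hts : t ≤ 2 * Real.pi - s) : Real.cos t ≤ Real.cos s := by
  rcases le_total t Real.pi with ht | ht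
  · exact Real.cos_le_cos_of_nonneg_of_le_pi hs ht hst
  · rw [← Real.cos_two_pi_sub t]
    exact Real.cos_le_cos_of_nonneg_of_le_pi hs (by linarith) (by linarith)

theorem cos_two_pi_div_mul_le {N k : ℕ} (hk : 0 < k) (hkN : k < N) :
    Real.cos (2 * Real.pi / N * k) ≤ Real.cos (2 * Real.pi / N) := by
  have hN : (0 : ℝ) < N := by exact_mod_cast hk.trans hkN
  have hs : 0 ≤ 2 * Real.pi / N := by positivity
  have hk1 : (1 : ℝ) ≤ k := by exact_mod_cast hk
  have hkN1 : (k : ℝ) + 1 ≤ N := by exact_mod_cast hkN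
  have hmul : 2 * Real.pi / N * N = 2 * Real.pi := div_mul_cancel₀ _ hN.ne'
  refine Real.cos_le_cos_of_le_of_le_two_pi_sub hs (le_mul_of_one_le_right hs hk1) ?_
  nlinarith [mul_le_mul_of_nonneg_left hkN1 hs]

theorem cos_two_pi_div_mul_sub_le {N j i : ℕ} (hj : j < N) (hi : i < N) (hji : j ≠ i) :
    Real.cos (2 * Real.pi / N * j - 2 * Real.pi / N * i) ≤ Real.cos (2 * Real.pi / N) := by
  rcases hji.lt_or_gt with h | h
  · have := cos_two_pi_div_mul_le (Nat.sub_pos_of_lt h) ((Nat.sub_le i j).trans_lt hi)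
    rwa [Nat.cast_sub h.le, mul_sub, ← Real.cos_neg, neg_sub] at this
  · have := cos_two_pi_div_mul_le (Nat.sub_pos_of_lt h) ((Nat.sub_le j i).trans_lt hj)
    rwa [Nat.cast_sub h.le, mul_sub] at this

theorem exp_two_pi_I_div_pow (N k : ℕ) :
    Complex.exp (2 * ↑Real.pi * Complex.I / N) ^ k =
      Complex.exp ((2 * Real.pi / N * k : ℝ) * Complex.I) := by
  rw [← Complex.exp_nat_mul]
  congr 1
  push_cast
  ring

theorem convex_setOf_norm_add_mul_le (a b : ℂ) (r : ℝ) : Convex ℝ {z : ℂ | ‖a + b * z‖ ≤ r} := by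
  have h := ((convex_closedBall (0 : ℂ) r).translate_preimage_right a).linear_preimage
    (LinearMap.mulLeft ℝ b)
  have hset : {z : ℂ | ‖a + b * z‖ ≤ r} =
      LinearMap.mulLeft ℝ b ⁻¹' ((fun x => a + x) ⁻¹' Metric.closedBall 0 r) := by
    ext z
    simp [dist_eq_norm, add_comm]
  rw [hset]
  exact h


/-- The maximality claim used in the proof of Lemma 4.1 of the paper.
Let `N ≥ 2`, `ξ = exp(2πi/N)`, `α, β ≥ 0` with `α + β = 1`, `i ∈ {0,…,N-1}` and let `z`
lie in the convex hull (in `ℂ`) of the `N`-th roots of unity different from `ξ^i`. Then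
`|αξ^i + βz| ≤ |αξ^i + βξ^(i+1)|`, and the right-hand side equals `|α + βξ|`. -/
theorem stmt2 (N : ℕ) (hN : 2 ≤ N) (α β : ℝ) (hα : 0 ≤ α) (hβ : 0 ≤ β) (hαβ : α + β = 1)
    (i : Fin N) (z : ℂ)
    (hz : z ∈ convexHull ℝ
      {w : ℂ | ∃ j : Fin N, j ≠ i ∧ w = Complex.exp (2 * ↑Real.pi * Complex.I / N) ^ (j : ℕ)}) :
    norm ((α : ℂ) * Complex.exp (2 * ↑Real.pi * Complex.I / N) ^ (i : ℕ) +
          (β : ℂ) * z) ≤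
        norm ((α : ℂ) * Complex.exp (2 * ↑Real.pi * Complex.I / N) ^ (i : ℕ) +
          (β : ℂ) * Complex.exp (2 * ↑Real.pi * Complex.I / N) ^ ((i : ℕ) + 1)) ∧
      norm ((α : ℂ) * Complex.exp (2 * ↑Real.pi * Complex.I / N) ^ (i : ℕ) +
          (β : ℂ) * Complex.exp (2 * ↑Real.pi * Complex.I / N) ^ ((i : ℕ) + 1)) =
        norm ((α : ℂ) + (β : ℂ) * Complex.exp (2 * ↑Real.pi * Complex.I / N)) := by
  constructor
  · refine convexHull_min ?_ (convex_setOf_norm_add_mul_le _ _ _) hz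
    rintro w ⟨j, hji, rfl⟩
    rw [Set.mem_ofPred_eq]
    simp only [exp_two_pi_I_div_pow]
    refine norm_add_exp_mul_I_le hα hβ ?_
    have h := cos_two_pi_div_mul_sub_le j.isLt i.isLt (Fin.val_ne_of_ne hji)
    rwa [← mul_sub _ (((i : ℕ) + 1 : ℕ) : ℝ), Nat.cast_succ, add_sub_cancel_left, mul_one]
  · have hξ : ‖Complex.exp (2 * ↑Real.pi * Complex.I / N) ^ (i : ℕ)‖ = 1 := by
      rw [exp_two_pi_I_div_pow, Complex.norm_exp_ofReal_mul_I]
    rw [← mul_one ‖(α : ℂ) + _‖, ← hξ, ← norm_mul]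
    congr 1
    ring
end

section
/- Assume the setting below. Then the following three conditions are equivalent: (1) Σ_{t=1}^{d} |A_{m,n}(t)|/q_{m,n} → 1 uniformly as m,n → ∞ with m < n; (2) for every t ∈ {1,…,d}, |A_{m,n}(t)|/q_{m,n} − P_{m,n}(t)/q_{m,n} → 0 uniformly as m,n → ∞ with m < n; (3) there exists a family of residues k_{m,n}(t) ∈ {0,…,b̄−1}, defined for all 1 ≤ m < n and t ∈ {1,…,d}, such that for every t ∈ {1,…,d}, K_{m,n}(t, k_{m,n}(t))/q_{m,n} − P_{m,n}(t)/q_{m,n} → 0 uniformly as m,n → ∞ with m < n. -/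
open Finset in
theorem norm_sum_le_card_of_norm_eq_one {ι : Type*} (s : Finset ι) {f : ι → ℂ}
    (hf : ∀ i, ‖f i‖ = 1) : ‖∑ i ∈ s, f i‖ ≤ (#s : ℝ) := by
  simpa [hf] using norm_sum_le s f

theorem exists_pos_le_one_sub_re_of_pow_eq_one {b : ℕ} (hb : 0 < b) :
    ∃ δ : ℝ, 0 < δ ∧ ∀ x : ℂ, x ^ b = 1 → x ≠ 1 → δ ≤ 1 - x.re := by
  classical
  let T : Finset ℂ := (Polynomial.nthRootsFinset b (1 : ℂ)).erase 1
  have hT : ∀ x, x ∈ T ↔ x ≠ 1 ∧ x ^ b = 1 := fun x => by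
    simp [T, Polynomial.mem_nthRootsFinset hb]
  have hpos : ∀ x ∈ T, 0 < 1 - x.re := fun x hx => by
    obtain ⟨hx1, hxb⟩ := (hT x).1 hx
    have hn : ‖x‖ = 1 := Complex.norm_eq_one_of_pow_eq_one hxb hb.ne'
    have hle : x.re ≤ 1 := hn ▸ Complex.re_le_norm x
    refine sub_pos.2 (lt_of_le_of_ne hle fun hre => hx1 ?_)
    have hsq : x.re * x.re + x.im * x.im = 1 := by
      rw [← Complex.normSq_apply, Complex.normSq_eq_norm_sq, hn, one_pow]
    refine Complex.ext (by simpa using hre) ?_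
    rw [hre] at hsq
    simpa using hsq
  rcases T.eq_empty_or_nonempty with h | h
  · refine ⟨1, one_pos, fun x hxb hx1 => ?_⟩
    have := (hT x).2 ⟨hx1, hxb⟩
    simp [h] at this
  · obtain ⟨y, hy, hmin⟩ := T.exists_min_image (fun x => 1 - x.re) h
    exact ⟨1 - y.re, hpos y hy, fun x hxb hx1 => hmin x ((hT x).2 ⟨hx1, hxb⟩)⟩

open Finset in
theorem sum_sum_one_sub_re_star_mul {ι : Type*} (s : Finset ι) (f : ι → ℂ) :
    ∑ i ∈ s, ∑ j ∈ s, (1 - (star (f i) * f j).re) =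
      (#s : ℝ) ^ 2 - ‖∑ i ∈ s, f i‖ ^ 2 := by
  have h : ∑ i ∈ s, ∑ j ∈ s, (star (f i) * f j).re = ‖∑ i ∈ s, f i‖ ^ 2 := by
    simp_rw [← Complex.re_sum, ← mul_sum, ← sum_mul, ← star_sum]
    rw [← Complex.normSq_eq_norm_sq, Complex.normSq_apply]
    simp
  simp_rw [sum_sub_distrib, h]
  simp [sq]

open Finset in
/-- If one residue class carries most of `s`, then the character sum is almost `#s`. -/
theorem card_sub_norm_sum_le {b : ℕ} {f : ℕ → ℂ} (hf : ∀ i, ‖f i‖ = 1)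
    (hmod : ∀ i j, f i = f j ↔ i % b = j % b) (s : Finset ℕ) (k : ℕ) :
    (#s : ℝ) - ‖∑ i ∈ s, f i‖ ≤ 2 * ((#s : ℝ) - #{i ∈ s | i % b = k}) := by
  have hcard : (#{i ∈ s | i % b = k} : ℝ) + #{i ∈ s | ¬ i % b = k} = #s := by
    exact_mod_cast s.card_filter_add_card_filter_not (fun i => i % b = k)
  have hmain : ‖∑ i ∈ s with i % b = k, f i‖ = #{i ∈ s | i % b = k} := by
    rcases (s.filter fun i => i % b = k).eq_empty_or_nonempty with h | ⟨j, hj⟩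
    · simp [h]
    · rw [sum_congr rfl fun i hi =>
        (hmod i j).2 ((mem_filter.1 hi).2.trans (mem_filter.1 hj).2.symm)]
      simp [hf]
  have hrest := norm_sum_le_card_of_norm_eq_one (s.filter fun i => ¬ i % b = k) hf
  have hsplit := sum_filter_add_sum_filter_not s (fun i => i % b = k) f
  have htri := norm_sub_norm_le (∑ i ∈ s with i % b = k, f i)
    (-∑ i ∈ s with ¬ i % b = k, f i)
  rw [sub_neg_eq_add, hsplit, norm_neg] at htri
  linarith

open Finset in
/-- If the character sum is almost `#s`, then a most popular residue class carries most of `s`. -/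
theorem mul_card_sub_card_filter_le {b : ℕ} {δ : ℝ} (hδ0 : 0 < δ)
    (hδ : ∀ x : ℂ, x ^ b = 1 → x ≠ 1 → δ ≤ 1 - x.re) {f : ℕ → ℂ} (hf : ∀ i, ‖f i‖ = 1)
    (hpow : ∀ i, f i ^ b = 1) (hmod : ∀ i j, f i = f j ↔ i % b = j % b)
    (s : Finset ℕ) {k : ℕ}
    (hk : ∀ i, #{j ∈ s | j % b = i % b} ≤ #{j ∈ s | j % b = k}) :
    δ * ((#s : ℝ) - #{i ∈ s | i % b = k}) ≤ 2 * ((#s : ℝ) - ‖∑ i ∈ s, f i‖) := by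
  have hstar : ∀ i, star (f i) * f i = 1 := fun i => by
    have := Complex.conj_mul' (f i)
    simpa [hf] using this
  have hrow : ∀ i ∈ s, δ * ((#s : ℝ) - #{i ∈ s | i % b = k}) ≤
      ∑ j ∈ s, (1 - (star (f i) * f j).re) := fun i _ => by
    have hterm : ∀ j ∈ s, δ * (1 - if j % b = i % b then 1 else 0) ≤
        1 - (star (f i) * f j).re := fun j _ => by
      split_ifs with h
      · simp only [(hmod j i).2 h, hstar]
        simp
      · rw [sub_zero, mul_one]
        refine hδ _ ?_ fun h1 => h ((hmod j i).1 ?_)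
        · rw [mul_pow, ← star_pow, hpow, hpow, star_one, one_mul]
        · rw [← hstar i] at h1
          exact mul_left_cancel₀ (left_ne_zero_of_mul_eq_one (hstar i)) h1
    refine le_trans ?_ (sum_le_sum hterm)
    rw [← mul_sum, sum_sub_distrib, sum_boole, sum_const, nsmul_one]
    have : (#{j ∈ s | j % b = i % b} : ℝ) ≤ #{j ∈ s | j % b = k} := by exact_mod_cast hk i
    gcongr
  have hsum := sum_le_sum hrow
  rw [sum_sum_one_sub_re_star_mul, sum_const, nsmul_eq_mul] at hsum
  have hA := norm_sum_le_card_of_norm_eq_one s hf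
  rcases s.eq_empty_or_nonempty with rfl | hs
  · simp
  · have hpos : (0 : ℝ) < #s := by exact_mod_cast hs.card_pos
    refine le_of_mul_le_mul_left (hsum.trans ?_) hpos
    nlinarith [norm_nonneg (∑ i ∈ s, f i)]


/-- Lemma 4.3 of the paper (equivalent conditions, for a fixed target vertex).
Setting: integers `d ≥ 1`, `b̄ ≥ 1`, positive integers `p m`, a complex number `λ` with
`|λ| = 1` such that `λ ^ (p m)` is a primitive `b̄`-th root of unity for all large `m`;
finite sets `S m n t ⊆ ℕ`, `q m n = Σ_t #(S m n t) > 0` for `1 ≤ m < n`,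
`P m n t = #(S m n t)`, `A m n t = Σ_{s ∈ S m n t} λ^{-p_m s}` and
`K m n t k = #{s ∈ S m n t : s ≡ k [MOD b̄]}`. Then the three stated uniform-convergence
conditions are equivalent. -/
theorem stmt4 (d b : ℕ) (hd : 1 ≤ d) (hb : 1 ≤ b)
    (p : ℕ → ℕ) (hp : ∀ m, 0 < p m)
    (lam : ℂ) (hlam : ‖lam‖ = 1)
    (hroot : ∃ M : ℕ, ∀ m ≥ M, IsPrimitiveRoot (lam ^ p m) b)
    (S : ℕ → ℕ → Fin d → Finset ℕ)
    (q : ℕ → ℕ → ℕ) (hq : ∀ m n, q m n = ∑ t, (S m n t).card)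
    (hqpos : ∀ m n, 1 ≤ m → m < n → 0 < q m n)
    (P : ℕ → ℕ → Fin d → ℕ) (hP : ∀ m n t, P m n t = (S m n t).card)
    (A : ℕ → ℕ → Fin d → ℂ)
    (hA : ∀ m n t, A m n t = ∑ s ∈ S m n t, lam ^ (-(p m * s : ℤ)))
    (K : ℕ → ℕ → Fin d → ℕ → ℕ)
    (hK : ∀ m n t k, K m n t k = ((S m n t).filter (fun s => s % b = k)).card) :
    -- (1) ↔ (2)
    ((∀ ε : ℝ, 0 < ε → ∃ N : ℕ, ∀ m n : ℕ, N ≤ m → m < n →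
        |(∑ t, ‖A m n t‖) / (q m n : ℝ) - 1| < ε) ↔
      (∀ ε : ℝ, 0 < ε → ∃ N : ℕ, ∀ m n : ℕ, N ≤ m → m < n → ∀ t : Fin d,
        |‖A m n t‖ / (q m n : ℝ) - (P m n t : ℝ) / (q m n : ℝ)| < ε)) ∧
    -- (1) ↔ (3)
    ((∀ ε : ℝ, 0 < ε → ∃ N : ℕ, ∀ m n : ℕ, N ≤ m → m < n →
        |(∑ t, ‖A m n t‖) / (q m n : ℝ) - 1| < ε) ↔
      (∃ kk : ℕ → ℕ → Fin d → ℕ, (∀ m n t, kk m n t < b) ∧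
        ∀ ε : ℝ, 0 < ε → ∃ N : ℕ, ∀ m n : ℕ, N ≤ m → m < n → ∀ t : Fin d,
          |(K m n t (kk m n t) : ℝ) / (q m n : ℝ) - (P m n t : ℝ) / (q m n : ℝ)| < ε)) := by
  obtain ⟨M, hM⟩ := hroot
  obtain ⟨δ, hδ0, hδ⟩ := exists_pos_le_one_sub_re_of_pow_eq_one (b := b) hb
  have hf : ∀ m s : ℕ, ‖lam ^ (-(p m * s : ℤ))‖ = 1 := fun m s => by
    rw [norm_zpow, hlam, one_zpow]
  have hfeq : ∀ m s : ℕ, lam ^ (-(p m * s : ℤ)) = ((lam ^ p m) ^ s)⁻¹ := fun m s => by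
    rw [zpow_neg, ← pow_mul]
    norm_cast
  have hpow : ∀ m ≥ M, ∀ s : ℕ, (lam ^ (-(p m * s : ℤ))) ^ b = 1 := fun m hm s => by
    rw [hfeq, inv_pow, pow_right_comm, (hM m hm).pow_eq_one, one_pow, inv_one]
  have hmod : ∀ m ≥ M, ∀ i j : ℕ,
      lam ^ (-(p m * i : ℤ)) = lam ^ (-(p m * j : ℤ)) ↔ i % b = j % b := fun m hm i j => by
    rw [hfeq, hfeq, inv_inj]
    rw [← pow_mod_orderOf _ i, ← pow_mod_orderOf _ j, ← (hM m hm).eq_orderOf]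
    exact ⟨fun h => (hM m hm).pow_inj (Nat.mod_lt i hb) (Nat.mod_lt j hb) h, fun h => by rw [h]⟩
  have hAP : ∀ m n t, ‖A m n t‖ ≤ (P m n t : ℝ) := fun m n t => by
    rw [hA, hP]
    exact norm_sum_le_card_of_norm_eq_one _ (hf m)
  have hKP : ∀ m n t k, (K m n t k : ℝ) ≤ (P m n t : ℝ) := fun m n t k => by
    rw [hK, hP]
    exact_mod_cast Finset.card_filter_le _ _
  have hsum : ∀ m n, 1 ≤ m → m < n → |(∑ t, ‖A m n t‖) / (q m n : ℝ) - 1| =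
      ∑ t, ((P m n t : ℝ) - ‖A m n t‖) / (q m n : ℝ) := fun m n hm hmn => by
    have hq0 : (0 : ℝ) < q m n := by exact_mod_cast hqpos m n hm hmn
    have hPq : ∑ t, (P m n t : ℝ) = q m n := by simp [hP, hq]
    have hle := Finset.sum_le_sum fun t (_ : t ∈ Finset.univ) => hAP m n t
    rw [← Finset.sum_div, Finset.sum_sub_distrib, hPq, abs_sub_comm, sub_div, div_self hq0.ne']
    refine abs_of_nonneg (sub_nonneg.2 ?_)
    rw [div_le_one hq0, ← hPq]
    exact hle
  have hdefA : ∀ m n t, |‖A m n t‖ / (q m n : ℝ) - (P m n t : ℝ) / (q m n : ℝ)| =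
      ((P m n t : ℝ) - ‖A m n t‖) / (q m n : ℝ) := fun m n t => by
    rw [abs_sub_comm, ← sub_div]
    exact abs_of_nonneg (div_nonneg (sub_nonneg.2 (hAP m n t)) (Nat.cast_nonneg _))
  have hdefK : ∀ m n t k, |(K m n t k : ℝ) / (q m n : ℝ) - (P m n t : ℝ) / (q m n : ℝ)| =
      ((P m n t : ℝ) - K m n t k) / (q m n : ℝ) := fun m n t k => by
    rw [abs_sub_comm, ← sub_div]
    exact abs_of_nonneg (div_nonneg (sub_nonneg.2 (hKP m n t k)) (Nat.cast_nonneg _))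
  simp only [hdefA, hdefK]
  refine (fun h12 => ⟨h12, h12.trans ?_⟩) ?_
  · constructor
    · intro h ε hε
      obtain ⟨N, hN⟩ := h ε hε
      refine ⟨max N 1, fun m n hm hmn t => ?_⟩
      have hlt := hN m n (le_of_max_le_left hm) hmn
      rw [hsum m n (le_of_max_le_right hm) hmn] at hlt
      refine lt_of_le_of_lt ?_ hlt
      exact Finset.single_le_sum (f := fun t => ((P m n t : ℝ) - ‖A m n t‖) / (q m n : ℝ))
        (fun t _ => div_nonneg (sub_nonneg.2 (hAP m n t)) (Nat.cast_nonneg _))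
        (Finset.mem_univ t)
    · intro h ε hε
      have hd0 : (0 : ℝ) < d := by exact_mod_cast hd
      obtain ⟨N, hN⟩ := h (ε / d) (by positivity)
      refine ⟨max N 1, fun m n hm hmn => ?_⟩
      rw [hsum m n (le_of_max_le_right hm) hmn]
      have hne : (Finset.univ : Finset (Fin d)).Nonempty := ⟨⟨0, hd⟩, Finset.mem_univ _⟩
      refine (Finset.sum_lt_sum_of_nonempty hne
        fun t _ => hN m n (le_of_max_le_left hm) hmn t).trans_eq ?_
      simp [mul_div_cancel₀ _ hd0.ne']
  · constructor
    · intro h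
      have hex : ∀ m n t, ∃ k < b, ∀ i, K m n t (i % b) ≤ K m n t k := fun m n t => by
        obtain ⟨k, hk, hmax⟩ := (Finset.range b).exists_max_image (K m n t) ⟨0, by simpa⟩
        exact ⟨k, by simpa using hk, fun i => hmax _ (by simpa using Nat.mod_lt i hb)⟩
      choose kk hkk hmax using hex
      refine ⟨kk, hkk, fun ε hε => ?_⟩
      obtain ⟨N, hN⟩ := h (δ / 2 * ε) (by positivity)
      refine ⟨max N M, fun m n hm hmn t => ?_⟩
      have hlt := hN m n (le_of_max_le_left hm) hmn t
      have hmM := le_of_max_le_right hm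
      have hkey : δ * ((P m n t : ℝ) - K m n t (kk m n t)) ≤
          2 * ((P m n t : ℝ) - ‖A m n t‖) := by
        simp only [hP, hK, hA]
        exact mul_card_sub_card_filter_le hδ0 hδ (hf m) (hpow m hmM) (hmod m hmM) _
          fun i => by simpa only [hK] using hmax m n t i
      have hdiv : δ * (((P m n t : ℝ) - K m n t (kk m n t)) / q m n) ≤
          2 * (((P m n t : ℝ) - ‖A m n t‖) / q m n) := by
        rw [← mul_div_assoc, ← mul_div_assoc]
        gcongr
      refine lt_of_mul_lt_mul_left ?_ hδ0.le
      linarith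
    · rintro ⟨kk, -, h⟩ ε hε
      obtain ⟨N, hN⟩ := h (ε / 2) (by positivity)
      refine ⟨max N M, fun m n hm hmn t => ?_⟩
      have hlt := hN m n (le_of_max_le_left hm) hmn t
      have hkey : (P m n t : ℝ) - ‖A m n t‖ ≤
          2 * ((P m n t : ℝ) - K m n t (kk m n t)) := by
        simp only [hP, hK, hA]
        exact card_sub_norm_sum_le (hf m) (hmod m (le_of_max_le_right hm)) _ _
      have hdiv : ((P m n t : ℝ) - ‖A m n t‖) / q m n ≤
          2 * (((P m n t : ℝ) - K m n t (kk m n t)) / q m n) := by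
        rw [← mul_div_assoc]
        gcongr
      linarith
end

section
/- Assume the setting below, with in addition: 1 ≤ b̄ ≤ d; q_{m,n} → ∞ uniformly (i.e., for every M there is N such that q_{m,n} ≥ M for all n > m ≥ N); for all 1 ≤ m < n and every k ∈ {0,…,b̄−1}, Σ_{t=1}^{d} K_{m,n}(t,k) equals ⌊q_{m,n}/b̄⌋ or ⌊q_{m,n}/b̄⌋ + 1; and that there is a family of residues k_{m,n}(t) ∈ {0,…,b̄−1} such that for every t ∈ {1,…,d}, K_{m,n}(t, k_{m,n}(t))/q_{m,n} − P_{m,n}(t)/q_{m,n} → 0 uniformly as m,n → ∞ with m < n. Define Ψ_{m,n} : {1,…,d} → {0,…,b̄−1} by Ψ_{m,n}(t) = k_{m,n}(t). Then: (1) there exists N such that for all n > m ≥ N the map Ψ_{m,n} is onto {0,…,b̄−1}; and (2) for every k ∈ {0,…,b̄−1}, Σ_{t ∈ Ψ_{m,n}^{−1}(k)} K_{m,n}(t,k)/q_{m,n} → 1/b̄ uniformly as m,n → ∞ with m < n. -/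
/-- Two distinct residue classes of a finite set are disjoint. -/
theorem card_filter_mod_add_card_filter_mod_le (s : Finset ℕ) (b : ℕ) {k l : ℕ} (hkl : k ≠ l) :
    (s.filter (fun x => x % b = k)).card + (s.filter (fun x => x % b = l)).card ≤ s.card := by
  rw [← Finset.card_union_of_disjoint]
  · exact Finset.card_le_card
      (Finset.union_subset (Finset.filter_subset _ _) (Finset.filter_subset _ _))
  · exact Finset.disjoint_filter.2 fun x _ hk hl => hkl (hk.symm.trans hl)

/-- If `T` is `⌊q / b⌋` or `⌊q / b⌋ + 1`, then `T / q` is within `1 / q` of `1 / b`. -/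
theorem abs_div_sub_one_div_le {T q b : ℕ} (hq : 0 < q) (hb : 0 < b)
    (hT : T = q / b ∨ T = q / b + 1) :
    |(T : ℝ) / q - 1 / b| ≤ 1 / q := by
  have hq' : (0 : ℝ) < q := by exact_mod_cast hq
  have hb' : (0 : ℝ) < b := by exact_mod_cast hb
  have hdiv := Nat.div_add_mod q b
  have hmod := Nat.mod_lt q hb
  have hmul := Nat.mul_div_le q b
  have hlower : q ≤ b * T + b := by
    rcases hT with rfl | rfl <;> nlinarith
  have hupper : b * T ≤ q + b := by
    rcases hT with rfl | rfl <;> nlinarith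
  have hlower' : (q : ℝ) ≤ b * T + b := by exact_mod_cast hlower
  have hupper' : (b : ℝ) * T ≤ q + b := by exact_mod_cast hupper
  have heq : (T : ℝ) / q - 1 / b = (b * T - q) / b / q := by
    field_simp
  rw [heq, abs_div, abs_of_pos hq']
  gcongr
  rw [abs_div, abs_of_pos hb', div_le_one hb', abs_le]
  constructor <;> linarith

/-- If each `f t` with `c t ≠ k` is at most `δ * q`, restricting the sum of `f` to the fibre of `c`
over `k` changes it, after division by `q`, by at most `card ι * δ`. -/
theorem abs_sum_fiber_div_sub_sum_div_le {ι : Type*} [Fintype ι] (c : ι → ℕ) (k : ℕ)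
    (f : ι → ℝ) (hf : ∀ t, 0 ≤ f t) {q δ : ℝ} (hq : 0 ≤ q) (hδ : 0 ≤ δ)
    (hfδ : ∀ t, c t ≠ k → f t / q ≤ δ) :
    |(∑ t ∈ Finset.univ.filter (fun t => c t = k), f t) / q - (∑ t, f t) / q|
      ≤ Fintype.card ι * δ := by
  rw [← Finset.sum_filter_add_sum_filter_not Finset.univ (fun t => c t = k) f, add_div,
    sub_add_cancel_left, abs_neg,
    abs_of_nonneg (div_nonneg (Finset.sum_nonneg fun t _ => hf t) hq), Finset.sum_div]
  calc ∑ t ∈ Finset.univ.filter (fun t => ¬ c t = k), f t / q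
      ≤ ∑ t ∈ Finset.univ.filter (fun t => ¬ c t = k), δ :=
        Finset.sum_le_sum fun t ht => hfδ t (Finset.mem_filter.1 ht).2
    _ ≤ ∑ _t : ι, δ :=
        Finset.sum_le_sum_of_subset_of_nonneg (Finset.filter_subset _ _) fun _ _ _ => hδ
    _ = Fintype.card ι * δ := by simp


/-- Lemma 5.1 of the paper.
In the setting of Lemma 4.3 (see the hypotheses), with additionally `1 ≤ b̄ ≤ d`,
`q_{m,n} → ∞` uniformly, identity (4.8) (`Σ_t K m n t k` equals `⌊q/b̄⌋` or `⌊q/b̄⌋ + 1`),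
and a family of residues `kk m n t ∈ {0,…,b̄-1}` such that
`K m n t (kk m n t)/q - P m n t/q → 0` uniformly, the maps `Ψ_{m,n}(t) = kk m n t`
are eventually onto `{0,…,b̄-1}` and, for every residue `k`,
`Σ_{t ∈ Ψ_{m,n}⁻¹(k)} K m n t k / q_{m,n} → 1/b̄` uniformly. -/
theorem stmt5 (d b : ℕ) (hd : 1 ≤ d) (hb : 1 ≤ b) (hbd : b ≤ d)
    (p : ℕ → ℕ) (hp : ∀ m, 0 < p m)
    (lam : ℂ) (hlam : ‖lam‖ = 1)
    (hroot : ∃ M : ℕ, ∀ m ≥ M, IsPrimitiveRoot (lam ^ p m) b)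
    (S : ℕ → ℕ → Fin d → Finset ℕ)
    (q : ℕ → ℕ → ℕ) (hq : ∀ m n, q m n = ∑ t, (S m n t).card)
    (hqpos : ∀ m n, 1 ≤ m → m < n → 0 < q m n)
    (hqinf : ∀ M : ℕ, ∃ N : ℕ, ∀ m n : ℕ, N ≤ m → m < n → M ≤ q m n)
    (P : ℕ → ℕ → Fin d → ℕ) (hP : ∀ m n t, P m n t = (S m n t).card)
    (A : ℕ → ℕ → Fin d → ℂ)
    (hA : ∀ m n t, A m n t = ∑ s ∈ S m n t, lam ^ (-(p m * s : ℤ)))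
    (K : ℕ → ℕ → Fin d → ℕ → ℕ)
    (hK : ∀ m n t k, K m n t k = ((S m n t).filter (fun s => s % b = k)).card)
    (hfloor : ∀ m n : ℕ, 1 ≤ m → m < n → ∀ k < b,
      (∑ t, K m n t k = q m n / b) ∨ (∑ t, K m n t k = q m n / b + 1))
    (kk : ℕ → ℕ → Fin d → ℕ) (hkk : ∀ m n t, kk m n t < b)
    (hconv : ∀ ε : ℝ, 0 < ε → ∃ N : ℕ, ∀ m n : ℕ, N ≤ m → m < n → ∀ t : Fin d,
      |(K m n t (kk m n t) : ℝ) / (q m n : ℝ) - (P m n t : ℝ) / (q m n : ℝ)| < ε) :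
    -- (1) the maps Ψ_{m,n} = kk m n are eventually onto {0,…,b-1}
    (∃ N : ℕ, ∀ m n : ℕ, N ≤ m → m < n → ∀ k < b, ∃ t : Fin d, kk m n t = k) ∧
    -- (2) for every residue k, the normalized fiber sums converge uniformly to 1/b
    (∀ k < b, ∀ ε : ℝ, 0 < ε → ∃ N : ℕ, ∀ m n : ℕ, N ≤ m → m < n →
      |(∑ t ∈ Finset.univ.filter (fun t : Fin d => kk m n t = k), (K m n t k : ℝ)) /
          (q m n : ℝ) - 1 / (b : ℝ)| < ε) := by
  have hlim : ∀ k < b, ∀ ε : ℝ, 0 < ε → ∃ N : ℕ, ∀ m n : ℕ, N ≤ m → m < n →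
      |(∑ t ∈ Finset.univ.filter (fun t : Fin d => kk m n t = k), (K m n t k : ℝ)) /
          (q m n : ℝ) - 1 / (b : ℝ)| < ε := by
    intro k hk ε hε
    have hd' : (0 : ℝ) < d := by exact_mod_cast hd
    have hδ : 0 < ε / (2 * d) := by positivity
    obtain ⟨N₁, hN₁⟩ := hconv _ hδ
    obtain ⟨M, hM⟩ := exists_nat_gt (2 / ε)
    obtain ⟨N₂, hN₂⟩ := hqinf M
    refine ⟨max 1 (max N₁ N₂), fun m n hm hmn => ?_⟩
    simp only [max_le_iff] at hm
    obtain ⟨hm₁, hmN₁, hmN₂⟩ := hm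
    have hq₀ : (0 : ℝ) < q m n := by exact_mod_cast hqpos m n hm₁ hmn
    have hqM : (M : ℝ) ≤ q m n := by exact_mod_cast hN₂ m n hmN₂ hmn
    have hqε : 1 / (q m n : ℝ) < ε / 2 := by
      rw [div_lt_iff₀ hq₀]
      have := (div_lt_iff₀ hε).1 (hM.trans_le hqM)
      linarith
    have htotal := abs_div_sub_one_div_le (hqpos m n hm₁ hmn) hb (hfloor m n hm₁ hmn k hk)
    have hfiber := abs_sum_fiber_div_sub_sum_div_le (kk m n) k (fun t => (K m n t k : ℝ))
      (fun t => Nat.cast_nonneg _) hq₀.le hδ.le (fun t ht => by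
        have hcard : (K m n t k : ℝ) + K m n t (kk m n t) ≤ P m n t := by
          rw [hK, hK, hP]
          exact_mod_cast card_filter_mod_add_card_filter_mod_le (S m n t) b ht.symm
        have hle := div_le_div_of_nonneg_right hcard hq₀.le
        rw [add_div] at hle
        have := (abs_lt.1 (hN₁ m n hmN₁ hmn t)).1
        linarith)
    have hhalf : (Fintype.card (Fin d) : ℝ) * (ε / (2 * d)) = ε / 2 := by
      rw [Fintype.card_fin]
      field_simp
    rw [hhalf] at hfiber
    push_cast at htotal
    refine (abs_sub_le _ _ _).trans_lt ((add_le_add hfiber htotal).trans_lt ?_)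
    linarith
  refine ⟨?_, hlim⟩
  have hb' : (0 : ℝ) < 1 / b := one_div_pos.2 (by exact_mod_cast hb)
  choose! N hN using fun k hk => hlim k hk _ hb'
  refine ⟨(Finset.range b).sup N, fun m n hm hmn k hk => ?_⟩
  by_contra! hne
  have hlt := hN k hk m n ((Finset.le_sup (Finset.mem_range.2 hk)).trans hm) hmn
  rw [Finset.filter_eq_empty_iff.2 fun t _ => hne t, Finset.sum_empty, zero_div, zero_sub,
    abs_neg, abs_of_pos hb'] at hlt
  exact hlt.false
end

section
/- Assume the setting below, with in addition: 1 ≤ b̄ ≤ d; q_{m,n} → ∞ uniformly (for every M there is N such that q_{m,n} ≥ M for all n > m ≥ N); and for all 1 ≤ m < n and every k ∈ {0,…,b̄−1}, Σ_{t=1}^{d} K_{m,n}(t,k) equals ⌊q_{m,n}/b̄⌋ or ⌊q_{m,n}/b̄⌋ + 1. Then the following are equivalent: (i) Σ_{t=1}^{d} |A_{m,n}(t)|/q_{m,n} → 1 uniformly as m,n → ∞ with m < n; (ii) there exists a family of maps Ψ_{m,n} : {1,…,d} → {0,…,b̄−1} (whose fibers form, for all n > m large enough, a partition of {1,…,d}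 into exactly b̄ nonempty atoms) such that for every k ∈ {0,…,b̄−1}, Σ_{t ∈ Ψ_{m,n}^{−1}(k)} |A_{m,n}(t)|/q_{m,n} → 1/b̄ uniformly as m,n → ∞ with m < n. -/
/-- Distinct `b`-th roots of unity in `ℂ` are uniformly separated. -/
theorem exists_pos_le_norm_sub_of_pow_eq_one {b : ℕ} (hb : 0 < b) :
    ∃ c : ℝ, 0 < c ∧ ∀ x y : ℂ, x ^ b = 1 → y ^ b = 1 → x ≠ y → c ≤ ‖x - y‖ := by
  set T := Polynomial.nthRootsFinset b (1 : ℂ)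
  have hT : ∀ x : ℂ, x ^ b = 1 → x ∈ T := fun x hx ↦
    (Polynomial.mem_nthRootsFinset hb _).2 hx
  rcases T.offDiag.eq_empty_or_nonempty with h | h
  · refine ⟨1, one_pos, fun x y hx hy hxy ↦ ?_⟩
    have : (x, y) ∈ T.offDiag := Finset.mem_offDiag.2 ⟨hT x hx, hT y hy, hxy⟩
    simp [h] at this
  · obtain ⟨z, hz, hmin⟩ := T.offDiag.exists_min_image (fun z ↦ ‖z.1 - z.2‖) h
    refine ⟨‖z.1 - z.2‖, norm_pos_iff.2 (sub_ne_zero.2 (Finset.mem_offDiag.1 hz).2.2),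
      fun x y hx hy hxy ↦ hmin (x, y) (Finset.mem_offDiag.2 ⟨hT x hx, hT y hy, hxy⟩)⟩

theorem Complex.norm_sub_sq_of_norm_eq_one {v z : ℂ} (hv : ‖v‖ = 1) (hz : ‖z‖ = 1) :
    ‖v - z‖ ^ 2 / 2 = 1 - (starRingEnd ℂ v * z).re := by
  have hv' : v.re * v.re + v.im * v.im = 1 := by
    rw [← Complex.normSq_apply, Complex.normSq_eq_norm_sq, hv, one_pow]
  have hz' : z.re * z.re + z.im * z.im = 1 := by
    rw [← Complex.normSq_apply, Complex.normSq_eq_norm_sq, hz, one_pow]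
  rw [← Complex.normSq_eq_norm_sq, Complex.normSq_apply]
  simp only [Complex.sub_re, Complex.sub_im, Complex.mul_re, Complex.conj_re, Complex.conj_im]
  linarith

/-- The defect of a sum of unit vectors from its maximal length, as a sum of squared distances
to the direction of the sum. -/
theorem Complex.exists_norm_eq_one_card_sub_norm_sum {ι : Type*} (S : Finset ι) (f : ι → ℂ)
    (hf : ∀ s ∈ S, ‖f s‖ = 1) :
    ∃ v : ℂ, ‖v‖ = 1 ∧ (S.card : ℝ) - ‖∑ s ∈ S, f s‖ = ∑ s ∈ S, ‖v - f s‖ ^ 2 / 2 := by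
  set a := ∑ s ∈ S, f s with ha
  obtain ⟨v, hv, hva⟩ : ∃ v : ℂ, ‖v‖ = 1 ∧ (starRingEnd ℂ v * a).re = ‖a‖ := by
    by_cases h : a = 0
    · exact ⟨1, by simp, by simp [h]⟩
    · have hn : (‖a‖ : ℂ) ≠ 0 := by simpa using h
      refine ⟨a / ‖a‖, by simp [h], ?_⟩
      rw [map_div₀, Complex.conj_ofReal, div_mul_eq_mul_div, mul_comm, Complex.mul_conj,
        Complex.normSq_eq_norm_sq, Complex.ofReal_pow, sq, mul_div_assoc, div_self hn, mul_one,
        Complex.ofReal_re]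
  refine ⟨v, hv, ?_⟩
  rw [Finset.sum_congr rfl fun s hs ↦ Complex.norm_sub_sq_of_norm_eq_one hv (hf s hs),
    Finset.sum_sub_distrib, ← Complex.re_sum, ← Finset.mul_sum, ← ha, hva]
  simp

/-- If an exponential sum over `S` at a primitive `b`-th root of unity is almost of maximal
modulus, then most elements of `S` lie in a single residue class modulo `b`. -/
theorem IsPrimitiveRoot.exists_residue_card_sub_le {b : ℕ} (hb : 0 < b) {c : ℝ} (hc : 0 < c)
    (hsep : ∀ x y : ℂ, x ^ b = 1 → y ^ b = 1 → x ≠ y → c ≤ ‖x - y‖)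
    {ζ : ℂ} (hζ : IsPrimitiveRoot ζ b) (S : Finset ℕ) :
    ∃ k < b, c ^ 2 / 8 * ((S.card : ℝ) - (S.filter (fun s ↦ s % b = k)).card) ≤
      S.card - ‖∑ s ∈ S, ζ ^ s‖ := by
  have hroot : ∀ s : ℕ, (ζ ^ s) ^ b = 1 := fun s ↦ by
    rw [← pow_mul, mul_comm, pow_mul, hζ.pow_eq_one, one_pow]
  obtain ⟨v, -, hv⟩ := Complex.exists_norm_eq_one_card_sub_norm_sum S (fun s ↦ ζ ^ s)
    (fun s _ ↦ by rw [norm_pow, hζ.norm'_eq_one hb.ne', one_pow])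
  obtain ⟨k, hk, hfar⟩ : ∃ k < b, ∀ s ∈ S, s % b ≠ k → c / 2 ≤ ‖v - ζ ^ s‖ := by
    by_cases h : ∃ r ∈ S, ‖v - ζ ^ r‖ < c / 2
    · obtain ⟨r, -, hr⟩ := h
      refine ⟨r % b, Nat.mod_lt _ hb, fun s _ hs ↦ ?_⟩
      have hne : ζ ^ r ≠ ζ ^ s := fun h ↦ hs <| by
        rw [pow_eq_pow_mod r hζ.pow_eq_one, pow_eq_pow_mod s hζ.pow_eq_one] at h
        exact (hζ.pow_inj (Nat.mod_lt _ hb) (Nat.mod_lt _ hb) h).symm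
      have hsr := hsep _ _ (hroot r) (hroot s) hne
      have htri := norm_sub_le_norm_sub_add_norm_sub (ζ ^ r) v (ζ ^ s)
      rw [norm_sub_rev (ζ ^ r) v] at htri
      linarith
    · push Not at h
      exact ⟨0, hb, fun s hs _ ↦ h s hs⟩
  refine ⟨k, hk, ?_⟩
  have hcard := S.card_filter_add_card_filter_not (fun s ↦ s % b = k)
  have hcard' : (S.card : ℝ) - (S.filter (fun s ↦ s % b = k)).card =
      (S.filter (fun s ↦ ¬ s % b = k)).card := by
    rw [← hcard]; push_cast; ring
  rw [hv, hcard', mul_comm, ← nsmul_eq_mul]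
  refine (Finset.card_nsmul_le_sum _ (fun s ↦ ‖v - ζ ^ s‖ ^ 2 / 2) _ fun s hs ↦ ?_).trans
    (Finset.sum_le_sum_of_subset_of_nonneg (Finset.filter_subset _ _) fun s _ _ ↦ by positivity)
  rw [Finset.mem_filter] at hs
  nlinarith [hfar s hs.1 hs.2]

/-- Let `P` be weights of total mass `q`, of which point `t` carries `K t k` in class `k < b`, each
class having total mass at most `q / b + 1`. If the loss `P t - a t` controls the mass of `t` outside
the class `ψ t`, then the fibers of `ψ` split the mass of `a` equally, up to an error controlled
by the total loss. -/
theorem abs_fiber_sum_sub_le {ι : Type*} [Fintype ι] {b : ℕ} (hb : 0 < b) {c q : ℝ} (hc : 0 < c)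
    (a P : ι → ℝ) (K : ι → ℕ → ℝ) (ψ : ι → ℕ) (hψ : ∀ t, ψ t < b)
    (ha : ∀ t, a t ≤ P t) (hK : ∀ t k, 0 ≤ K t k) (hKP : ∀ t k, K t k ≤ P t)
    (hq : ∑ t, P t = q) (hdef : ∀ t, c * (P t - K t (ψ t)) ≤ P t - a t)
    (hcol : ∀ k < b, ∑ t, K t k ≤ q / b + 1) {k : ℕ} (hk : k < b) :
    |∑ t with ψ t = k, a t - q / b| ≤ (q - ∑ t, a t) + b * (1 + (q - ∑ t, a t) / c) := by
  set D := q - ∑ t, a t with hD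
  have hDsum : D = ∑ t, (P t - a t) := by rw [Finset.sum_sub_distrib, hq]
  have hD0 : 0 ≤ D := hDsum ▸ Finset.sum_nonneg fun t _ ↦ sub_nonneg.2 (ha t)
  have hloss : ∑ t, (P t - K t (ψ t)) ≤ D / c := by
    rw [le_div_iff₀' hc, Finset.mul_sum, hDsum]
    exact Finset.sum_le_sum fun t _ ↦ hdef t
  have hupper : ∀ j < b, ∑ t with ψ t = j, a t ≤ q / b + (1 + D / c) := by
    intro j hj
    calc ∑ t with ψ t = j, a t
        ≤ ∑ t with ψ t = j, (K t j + (P t - K t (ψ t))) := Finset.sum_le_sum fun t ht ↦ by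
          rw [(Finset.mem_filter.1 ht).2]; linarith [ha t]
      _ ≤ ∑ t, (K t j + (P t - K t (ψ t))) :=
          Finset.sum_le_sum_of_subset_of_nonneg (Finset.filter_subset _ _) fun t _ _ ↦
            add_nonneg (hK t j) (sub_nonneg.2 (hKP t _))
      _ ≤ q / b + (1 + D / c) := by
          rw [Finset.sum_add_distrib]; linarith [hcol j hj]
  have htotal : ∑ j ∈ Finset.range b, ∑ t with ψ t = j, a t = q - D := by
    rw [Finset.sum_fiberwise_of_maps_to fun t _ ↦ Finset.mem_range.2 (hψ t), hD]; ring
  have hE : 0 ≤ 1 + D / c := by positivity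
  have hb1 : (1 : ℝ) ≤ b := by exact_mod_cast hb
  have hrest : ∑ j ∈ (Finset.range b).erase k, ∑ t with ψ t = j, a t ≤
      (b - 1) * (q / b + (1 + D / c)) := by
    refine (Finset.sum_le_card_nsmul _ _ _ fun j hj ↦
      hupper j (Finset.mem_range.1 (Finset.mem_of_mem_erase hj))).trans_eq ?_
    rw [Finset.card_erase_of_mem (Finset.mem_range.2 hk), Finset.card_range, nsmul_eq_mul,
      Nat.cast_sub hb, Nat.cast_one]
  have hsplit := Finset.add_sum_erase (Finset.range b) (fun j ↦ ∑ t with ψ t = j, a t)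
    (Finset.mem_range.2 hk)
  have hqb : (b : ℝ) * (q / b) = q := by field_simp
  rw [abs_le]
  constructor
  · simp only [htotal] at hsplit
    nlinarith
  · nlinarith [hupper k hk]


/-- Combinatorial content of Corollary 3.5 of the paper (combining Lemmas 4.3 and 5.1).
In the setting of Lemma 4.3, with `1 ≤ b̄ ≤ d`, `q_{m,n} → ∞` uniformly and
identity (4.8), the condition `Σ_t |A m n t| / q → 1` uniformly is equivalent to the
existence of maps `Ψ_{m,n} : {1,…,d} → {0,…,b̄-1}` whose fibers form, for all large
`n > m`, a partition of `{1,…,d}` into exactly `b̄` nonempty atoms, such that for every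
`k`, `Σ_{t ∈ Ψ_{m,n}⁻¹(k)} |A m n t| / q_{m,n} → 1/b̄` uniformly. -/
theorem stmt6 (d b : ℕ) (hd : 1 ≤ d) (hb : 1 ≤ b) (hbd : b ≤ d)
    (p : ℕ → ℕ) (hp : ∀ m, 0 < p m)
    (lam : ℂ) (hlam : ‖lam‖ = 1)
    (hroot : ∃ M : ℕ, ∀ m ≥ M, IsPrimitiveRoot (lam ^ p m) b)
    (S : ℕ → ℕ → Fin d → Finset ℕ)
    (q : ℕ → ℕ → ℕ) (hq : ∀ m n, q m n = ∑ t, (S m n t).card)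
    (hqpos : ∀ m n, 1 ≤ m → m < n → 0 < q m n)
    (hqinf : ∀ M : ℕ, ∃ N : ℕ, ∀ m n : ℕ, N ≤ m → m < n → M ≤ q m n)
    (P : ℕ → ℕ → Fin d → ℕ) (hP : ∀ m n t, P m n t = (S m n t).card)
    (A : ℕ → ℕ → Fin d → ℂ)
    (hA : ∀ m n t, A m n t = ∑ s ∈ S m n t, lam ^ (-(p m * s : ℤ)))
    (K : ℕ → ℕ → Fin d → ℕ → ℕ)
    (hK : ∀ m n t k, K m n t k = ((S m n t).filter (fun s => s % b = k)).card)
    (hfloor : ∀ m n : ℕ, 1 ≤ m → m < n → ∀ k < b,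
      (∑ t, K m n t k = q m n / b) ∨ (∑ t, K m n t k = q m n / b + 1)) :
    -- (i) ↔ (ii)
    ((∀ ε : ℝ, 0 < ε → ∃ N : ℕ, ∀ m n : ℕ, N ≤ m → m < n →
        |(∑ t, ‖A m n t‖) / (q m n : ℝ) - 1| < ε) ↔
      (∃ Ψ : ℕ → ℕ → Fin d → ℕ, (∀ m n t, Ψ m n t < b) ∧
        -- for all large n > m the b fibers of Ψ_{m,n} are all nonempty
        (∃ N : ℕ, ∀ m n : ℕ, N ≤ m → m < n → ∀ k < b, ∃ t : Fin d, Ψ m n t = k) ∧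
        (∀ k < b, ∀ ε : ℝ, 0 < ε → ∃ N : ℕ, ∀ m n : ℕ, N ≤ m → m < n →
          |(∑ t ∈ Finset.univ.filter (fun t : Fin d => Ψ m n t = k),
              ‖A m n t‖) / (q m n : ℝ) - 1 / (b : ℝ)| < ε))) := by
  have hb0 : (0 : ℝ) < b := by exact_mod_cast hb
  constructor
  · intro hlim
    obtain ⟨c, hc, hsep⟩ := exists_pos_le_norm_sub_of_pow_eq_one hb
    obtain ⟨M, hM⟩ := hroot
    have hres : ∀ m n t, ∃ k < b, M ≤ m → c ^ 2 / 8 * ((P m n t : ℝ) - K m n t k) ≤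
        P m n t - ‖A m n t‖ := by
      intro m n t
      by_cases hm : M ≤ m
      · obtain ⟨k, hk, h⟩ := (hM m hm).inv.exists_residue_card_sub_le hb hc hsep (S m n t)
        refine ⟨k, hk, fun _ ↦ ?_⟩
        have hsum : A m n t = ∑ s ∈ S m n t, ((lam ^ p m)⁻¹) ^ s := by
          rw [hA]
          refine Finset.sum_congr rfl fun s _ ↦ ?_
          rw [zpow_neg, ← Nat.cast_mul, zpow_natCast, pow_mul, inv_pow]
        rwa [hP, hK, hsum]
      · exact ⟨0, hb, fun h ↦ absurd h hm⟩
    choose Ψ hΨ hdef using hres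
    have hnorm : ∀ m n t, ‖A m n t‖ ≤ P m n t := by
      intro m n t
      rw [hA, hP]
      refine (norm_sum_le _ _).trans_eq ?_
      simp [norm_zpow, hlam]
    have hconv : ∀ ε : ℝ, 0 < ε → ∃ N : ℕ, ∀ m n : ℕ, N ≤ m → m < n → ∀ k < b,
        |(∑ t with Ψ m n t = k, ‖A m n t‖) / (q m n : ℝ) - 1 / (b : ℝ)| < ε := by
      intro ε hε
      set C : ℝ := 1 + b / (c ^ 2 / 8) with hC
      have hC0 : 0 < C := by positivity
      obtain ⟨N₁, hN₁⟩ := hlim (ε / 2 / C) (by positivity)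
      obtain ⟨R, hR⟩ := exists_nat_gt (b / (ε / 2))
      obtain ⟨N₂, hN₂⟩ := hqinf R
      refine ⟨max (max N₁ N₂) (max M 1), fun m n hm hmn k hk ↦ ?_⟩
      simp only [max_le_iff] at hm
      obtain ⟨⟨hm₁, hm₂⟩, hmM, hm1⟩ := hm
      have hq0 : (0 : ℝ) < q m n := by exact_mod_cast hqpos m n hm1 hmn
      have hRq : (b : ℝ) < ε / 2 * q m n := by
        rw [← div_lt_iff₀' (by positivity)]
        exact hR.trans_le (by exact_mod_cast hN₂ m n hm₂ hmn)
      have hbound := abs_fiber_sum_sub_le hb (c := c ^ 2 / 8) (q := q m n) (by positivity)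
        (fun t ↦ ‖A m n t‖) (fun t ↦ (P m n t : ℝ)) (fun t k ↦ (K m n t k : ℝ)) (Ψ m n)
        (hΨ m n) (hnorm m n) (fun _ _ ↦ Nat.cast_nonneg _)
        (fun t k ↦ by rw [hK, hP]; exact_mod_cast Finset.card_filter_le _ _)
        (by simp only [hq, hP]; push_cast; rfl) (fun t ↦ hdef m n t hmM)
        (fun k hk ↦ by
          have hle : ∑ t, K m n t k ≤ q m n / b + 1 := by
            rcases hfloor m n hm1 hmn k hk with h | h <;> omega
          have hle' : (∑ t, (K m n t k : ℝ)) ≤ ((q m n / b : ℕ) : ℝ) + 1 := by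
            exact_mod_cast hle
          linarith [Nat.cast_div_le (α := ℝ) (m := q m n) (n := b)])
        hk
      set D : ℝ := q m n - ∑ t, ‖A m n t‖ with hD
      have hDq : C * D < ε / 2 * q m n := by
        have h := (abs_lt.1 (hN₁ m n hm₁ hmn)).1
        rw [lt_sub_iff_add_lt, lt_div_iff₀ hq0] at h
        have h' : D < ε / 2 / C * q m n := by rw [hD]; linarith
        calc C * D < C * (ε / 2 / C * q m n) := by gcongr
          _ = ε / 2 * q m n := by field_simp
      have hlt : |∑ t with Ψ m n t = k, ‖A m n t‖ - (q m n : ℝ) / b| < ε * q m n := by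
        refine hbound.trans_lt ?_
        have : D + b * (1 + D / (c ^ 2 / 8)) = C * D + b := by rw [hC]; ring
        linarith
      have hdiv : (∑ t with Ψ m n t = k, ‖A m n t‖) / (q m n : ℝ) - 1 / (b : ℝ) =
          (∑ t with Ψ m n t = k, ‖A m n t‖ - (q m n : ℝ) / b) / q m n := by
        field_simp
      rwa [hdiv, abs_div, abs_of_pos hq0, div_lt_iff₀ hq0]
    refine ⟨Ψ, hΨ, ?_, fun k hk ε hε ↦ ?_⟩
    · obtain ⟨N, hN⟩ := hconv (1 / b) (by positivity)
      refine ⟨N, fun m n hm hmn k hk ↦ ?_⟩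
      by_contra! hne
      have h := hN m n hm hmn k hk
      rw [Finset.filter_false_of_mem fun t _ ↦ hne t, Finset.sum_empty, zero_div, zero_sub,
        abs_neg, abs_of_pos (by positivity)] at h
      exact lt_irrefl _ h
    · obtain ⟨N, hN⟩ := hconv ε hε
      exact ⟨N, fun m n hm hmn ↦ hN m n hm hmn k hk⟩
  · rintro ⟨Ψ, hΨ, -, hconv⟩ ε hε
    have hconv' : ∀ k, ∃ N : ℕ, k < b → ∀ m n : ℕ, N ≤ m → m < n →
        |(∑ t with Ψ m n t = k, ‖A m n t‖) / (q m n : ℝ) - 1 / (b : ℝ)| < ε / b := by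
      intro k
      by_cases hk : k < b
      · obtain ⟨N, hN⟩ := hconv k hk (ε / b) (by positivity)
        exact ⟨N, fun _ ↦ hN⟩
      · exact ⟨0, fun h ↦ absurd h hk⟩
    choose N hN using hconv'
    refine ⟨(Finset.range b).sup N, fun m n hm hmn ↦ ?_⟩
    have hsplit : (∑ t, ‖A m n t‖) / (q m n : ℝ) - 1 = ∑ k ∈ Finset.range b,
        ((∑ t with Ψ m n t = k, ‖A m n t‖) / (q m n : ℝ) - 1 / (b : ℝ)) := by
      rw [Finset.sum_sub_distrib, ← Finset.sum_div,
        Finset.sum_fiberwise_of_maps_to fun t _ ↦ Finset.mem_range.2 (hΨ m n t)]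
      simp [hb0.ne']
    rw [hsplit]
    calc _ ≤ ∑ k ∈ Finset.range b,
          |(∑ t with Ψ m n t = k, ‖A m n t‖) / (q m n : ℝ) - 1 / (b : ℝ)| :=
          Finset.abs_sum_le_sum_abs _ _
      _ < ∑ _k ∈ Finset.range b, ε / b :=
          Finset.sum_lt_sum_of_nonempty ⟨0, Finset.mem_range.2 hb⟩ fun k hk ↦
            hN k (Finset.mem_range.1 hk) m n ((Finset.le_sup hk).trans hm) hmn
      _ = ε := by simp [field]
end

section
/- Let N be a positive integer and ξ = exp(2πi/N). Then there exist constants C > 0 and ε₀ > 0 such that for every 0 < ε ≤ ε₀ and every convex combination w = Σ_{j=0}^{N−1} α_j ξ^j of the N-th roots of unity (α_j ≥ 0, Σ_{j=0}^{N−1} α_j = 1) satisfying |w − 1| < ε, one has α_0 > 1 − Cε. -/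
/-- A complex number of norm one other than `1` has real part less than `1`. -/
theorem re_lt_one_of_norm_eq_one {z : ℂ} (hz : ‖z‖ = 1) (h1 : z ≠ 1) : z.re < 1 := by
  refine lt_of_le_of_ne (hz ▸ Complex.re_le_norm z) fun hre => h1 ?_
  have hsq : z.re * z.re + z.im * z.im = 1 := by
    rw [← Complex.normSq_apply, Complex.normSq_eq_norm_sq, hz, one_pow]
  have him : z.im = 0 := by
    rw [hre] at hsq
    exact mul_self_eq_zero.mp (by linarith)
  exact Complex.ext hre him

/-- If a cost `c` is positive away from `i₀`, then the mass of a probability vector away from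
`i₀` is bounded by a constant multiple of its average cost. -/
theorem exists_one_sub_le_mul_sum {ι : Type*} [Fintype ι] (i₀ : ι) (c : ι → ℝ)
    (hc : ∀ i, 0 ≤ c i) (hpos : ∀ i, i ≠ i₀ → 0 < c i) :
    ∃ C : ℝ, 0 < C ∧ ∀ α : ι → ℝ, (∀ i, 0 ≤ α i) → ∑ i, α i = 1 →
      1 - α i₀ ≤ C * ∑ i, α i * c i := by
  classical
  have hinv : ∀ i, 0 ≤ (c i)⁻¹ := fun i => inv_nonneg.mpr (hc i)
  have hC : 0 < 1 + ∑ i, (c i)⁻¹ := by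
    have := Finset.sum_nonneg fun i (_ : i ∈ Finset.univ) => hinv i
    linarith
  refine ⟨1 + ∑ i, (c i)⁻¹, hC, fun α hα hsum => ?_⟩
  have hsplit : 1 - α i₀ = ∑ i ∈ Finset.univ.erase i₀, α i := by
    rw [← hsum, ← Finset.add_sum_erase _ _ (Finset.mem_univ i₀), add_sub_cancel_left]
  rw [hsplit, Finset.mul_sum]
  refine (Finset.sum_le_sum fun i hi => ?_).trans
    (Finset.sum_le_sum_of_subset_of_nonneg (Finset.erase_subset i₀ _)
      fun i _ _ => mul_nonneg hC.le (mul_nonneg (hα i) (hc i)))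
  have hci := hpos i (Finset.ne_of_mem_erase hi)
  have hle : (c i)⁻¹ ≤ 1 + ∑ i, (c i)⁻¹ := by
    have := Finset.single_le_sum (fun i _ => hinv i) (Finset.mem_univ i)
    linarith
  calc α i = (c i)⁻¹ * (α i * c i) := by field_simp
    _ ≤ _ := mul_le_mul_of_nonneg_right hle (mul_nonneg (hα i) (hc i))


/-- Refinement of Lemma 4.1 of the paper, used in the sufficiency part of the proof of
Theorem 3.2: if a convex combination `w = Σ_{j<N} α_j ξ^j` of the `N`-th roots of unity
(`ξ = exp(2πi/N)`) satisfies `|w - 1| < ε` for small enough `ε`, then the coefficient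
attached to the root of unity `1` satisfies `α_0 > 1 - Cε`. -/
theorem stmt8 (N : ℕ) (hN : 0 < N) :
    ∃ C ε₀ : ℝ, 0 < C ∧ 0 < ε₀ ∧
      ∀ ε : ℝ, 0 < ε → ε ≤ ε₀ →
        ∀ α : Fin N → ℝ, (∀ j, 0 ≤ α j) → (∑ j, α j = 1) →
          ‖(∑ j : Fin N,
              (α j : ℂ) * Complex.exp (2 * ↑Real.pi * Complex.I / N) ^ (j : ℕ)) - 1‖ < ε →
          1 - C * ε < α ⟨0, hN⟩ := by
  have hξ := Complex.isPrimitiveRoot_exp N hN.ne'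
  set ξ := Complex.exp (2 * ↑Real.pi * Complex.I / N)
  have hnorm : ∀ j : ℕ, ‖ξ ^ j‖ = 1 := fun j => by
    rw [norm_pow, hξ.norm'_eq_one hN.ne', one_pow]
  obtain ⟨C, hC, hbound⟩ := exists_one_sub_le_mul_sum (⟨0, hN⟩ : Fin N)
    (fun j => 1 - (ξ ^ (j : ℕ)).re)
    (fun j => sub_nonneg.mpr (hnorm j ▸ Complex.re_le_norm _))
    (fun j hj => sub_pos.mpr (re_lt_one_of_norm_eq_one (hnorm j)
      (hξ.pow_ne_one_of_pos_of_lt (fun h => hj (Fin.ext h)) j.isLt)))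
  refine ⟨C, 1, hC, one_pos, fun ε _ _ α hα hsum hw => ?_⟩
  have hre : ∑ j : Fin N, α j * (1 - (ξ ^ (j : ℕ)).re) =
      -((∑ j : Fin N, (α j : ℂ) * ξ ^ (j : ℕ)) - 1).re := by
    simp only [Complex.sub_re, Complex.re_sum, Complex.re_ofReal_mul, Complex.one_re, mul_sub,
      mul_one, Finset.sum_sub_distrib, hsum, neg_sub]
  have hlt : ∑ j : Fin N, α j * (1 - (ξ ^ (j : ℕ)).re) < ε :=
    hre ▸ ((neg_le_abs _).trans (Complex.abs_re_le_norm _)).trans_lt hw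
  have := hbound α hα hsum
  have := mul_lt_mul_of_pos_left hlt hC
  linarith
end
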